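/- arXiv:1808.02680 — 2 statements merged into one kernel-verified Lean document; each statement's English description precedes it below -/
import Mathlib

section
/- For any R-bLSP morphism f and any infinite word w over the domain alphabet of f, if f(w) is LSP then w is LSP. -/
section LSPDefs

variable {A : Type*} {B : Type*}

/-- `u` is a prefix of the infinite word `w`. -/
def IsPrefixI (u : List A) (w : ℕ → A) : Prop :=
  ∀ (i : ℕ) (h : i < u.length), u.get ⟨i, h⟩ = w i

/-- `u` is a factor of the infinite word `w`. -/
def IsFactorI (u : List A) (w : ℕ → A) : Prop :=
  ∃ k : ℕ, ∀ (i : ℕ) (h : i < u.length), u.get ⟨i, h⟩ = w (k + i)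

/-- `u` is a left special factor of the infinite word `w`. -/
def LeftSpecialI (u : List A) (w : ℕ → A) : Prop :=
  ∃ a b : A, a ≠ b ∧ IsFactorI (a :: u) w ∧ IsFactorI (b :: u) w

/-- An infinite word is LSP if all its left special factors are prefixes of it. -/
def IsLSP (w : ℕ → A) : Prop :=
  ∀ u : List A, LeftSpecialI u w → IsPrefixI u w

/-- Application of a morphism (given by images of letters) to a finite word. -/
def applyM (f : A → List B) (u : List A) : List B := (u.map f).flatten

/-- The prefix of length `n` of an infinite word. -/
def infPrefix (w : ℕ → A) (n : ℕ) : List A := List.ofFn (fun i : Fin n => w i)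

/-- `x` is the image of the infinite word `w` under the morphism `f`. -/
def InfImage (f : A → List B) (w : ℕ → A) (x : ℕ → B) : Prop :=
  ∀ n : ℕ, IsPrefixI (applyM f (infPrefix w n)) x

/-- `f` is a basic LSP (bLSP) endomorphism. -/
def IsBLSP (f : A → List A) : Prop :=
  ∃ α : A, f α = [α] ∧ ∀ β : A, β ≠ α → ∃ γ : A, f β = f γ ++ [β]

/-- `f` is an R-bLSP morphism with domain alphabet `D`: the restriction to `D` of a
bLSP morphism `g` (letters outside the domain are sent to `[]`). -/
def IsRBLSPOn (D : Set A) (f : A → List A) : Prop :=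
  (∀ x : A, x ∈ D ↔ f x ≠ []) ∧ ∃ g : A → List A, IsBLSP g ∧ ∀ x ∈ D, f x = g x

/-- The episturmian morphism `L_α`. -/
def Lmor [DecidableEq A] (α : A) : A → List A := fun β => if β = α then [α] else [α, β]

/-- `u` is an `(a,b,c,β,γ)`-fragility of `w`. -/
def Frag5 (w : ℕ → A) (a b c β γ : A) (u : List A) : Prop :=
  IsPrefixI (u ++ [a]) w ∧ IsFactorI (β :: (u ++ [b])) w ∧ IsFactorI (γ :: (u ++ [c])) w

/-- `w` is `(a,b,c)`-fragile. -/
def Fragile (w : ℕ → A) (a b c : A) : Prop :=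
  ∃ (u : List A) (β γ : A), β ≠ γ ∧ Frag5 w a b c β γ u

/-- `f` is LSP `(a,b,c)`-breaking (for words over the domain `D` of `f`). -/
def Breaking (D : Set A) (f : A → List A) (a b c : A) : Prop :=
  ∀ (w x : ℕ → A), Set.range w ⊆ D → IsLSP w → Fragile w a b c →
    InfImage f w x → ¬ IsLSP x

/-- Length of the longest common prefix of two finite words. -/
noncomputable def lcpLen (u v : List A) : ℕ :=
  sSup {n | n ≤ u.length ∧ n ≤ v.length ∧ u.take n = v.take n}

/-- A morphism is nonerasing if images of letters are nonempty. -/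
def Nonerasing (f : A → List B) : Prop := ∀ a : A, f a ≠ []

/-- `f` preserves the LSP property for infinite words. -/
def PreservesLSP (f : A → List B) : Prop :=
  ∀ (w : ℕ → A) (x : ℕ → B), IsLSP w → InfImage f w x → IsLSP x

/-- `f ∈ U(A,B)`: nonerasing and each letter of `B` occurs at most once in total
among the images of letters. -/
def InU [Fintype A] [DecidableEq B] (f : A → List B) : Prop :=
  Nonerasing f ∧ ∀ b : B, (∑ a : A, (f a).count b) ≤ 1

/-- `u^k`. -/
def listPow (u : List B) (k : ℕ) : List B := (List.replicate k u).flatten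

/-- `x = u^ω`. -/
def IsOmegaPow (u : List B) (x : ℕ → B) : Prop := ∀ k : ℕ, IsPrefixI (listPow u k) x

/-- `f ∈ P_LSP(A,B)`: nonerasing, all images are positive powers of a word `u`
with `u^ω` LSP. -/
def InPLSP (f : A → List B) : Prop :=
  Nonerasing f ∧ ∃ u : List B, u ≠ [] ∧ (∀ a : A, ∃ k : ℕ, 0 < k ∧ f a = listPow u k) ∧
    ∀ x : ℕ → B, IsOmegaPow u x → IsLSP x

/-- `r` is the primitive root of `w`. -/
def IsPrimRoot (r w : List B) : Prop :=
  (∃ k : ℕ, 0 < k ∧ w = listPow r k) ∧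
  ∀ (v : List B) (k : ℕ), 0 < k → w = listPow v k → r.length ≤ v.length

/-- Compatibility of a chain of morphisms `[g_1, …, g_n]` (composition
`g_1 ∘ ⋯ ∘ g_n`): every letter produced by `g_{i+1}` lies in the domain of `g_i`. -/
def CompatChain (L : List (B → List B)) : Prop :=
  List.Chain' (fun g h => ∀ x y, y ∈ h x → g y ≠ []) L

end LSPDefs

theorem blsp_shape {A : Type*} (g : A → List A) (hg : IsBLSP g) :
    ∃ α : A, ∀ β : A, ∃ t : List A, g β = α :: t ∧ α ∉ t ∧ ∃ s, g β = s ++ [β] := by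
  obtain ⟨α, h1, h2⟩ := hg
  refine ⟨α, ?_⟩
  have key : ∀ (n : ℕ) (β : A), (g β).length = n →
      ∃ t : List A, g β = α :: t ∧ α ∉ t ∧ ∃ s, g β = s ++ [β] := by
    intro n
    induction n using Nat.strong_induction_on with
    | _ n ih =>
      intro β hn
      by_cases hb : β = α
      · subst hb
        exact ⟨[], h1, by simp, [], by simp [h1]⟩
      · obtain ⟨γ, hγ⟩ := h2 β hb
        obtain ⟨t, ht, ht2, -⟩ := ih (g γ).length (by rw [← hn, hγ]; simp) γ rfl
        refine ⟨t ++ [β], by rw [hγ, ht]; simp, ?_, g γ, hγ⟩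
        simp only [List.mem_append, List.mem_singleton, not_or]
        exact ⟨ht2, fun h => hb h.symm⟩
  exact fun β => key _ β rfl

theorem lsp_abstract {A : Type*} (w x : ℕ → A) (α : A) (P : ℕ → ℕ) (L : A → ℕ) (F : A → ℕ → A)
    (h0 : P 0 = 0) (hP : ∀ n, P (n+1) = P n + L (w n)) (hL : ∀ n, 0 < L (w n))
    (hF : ∀ n i, i < L (w n) → x (P n + i) = F (w n) i)
    (hα : ∀ n, F (w n) 0 = α) (hα' : ∀ n i, 0 < i → i < L (w n) → F (w n) i ≠ α)
    (hlast : ∀ n, F (w n) (L (w n) - 1) = w n) (hLSP : IsLSP x) : IsLSP w := by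
  have hx0 : ∀ n, x (P n) = α := fun n => by
    rw [← hα n, ← hF n 0 (hL n)]; simp
  have hxl : ∀ n, ∀ j, j + 1 = P (n+1) → x j = w n := fun n j hj => by
    have := hP n
    have := hL n
    rw [← hlast n, ← hF n _ (by omega)]
    congr 1; omega
  rintro u ⟨a, b, hab, ⟨k, hk⟩, ⟨k', hk'⟩⟩
  have hka : w k = a := by simpa using (hk 0 (by simp)).symm
  have hkb : w k' = b := by simpa using (hk' 0 (by simp)).symm
  have hu : ∀ i (h : i < u.length), u[i] = w (k + 1 + i) := fun i h => by
    have := hk (i+1) (by simpa using h)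
    simp only [List.get_eq_getElem, List.getElem_cons_succ] at this
    rw [this]; congr 1; omega
  have hu' : ∀ i (h : i < u.length), u[i] = w (k' + 1 + i) := fun i h => by
    have := hk' (i+1) (by simpa using h)
    simp only [List.get_eq_getElem, List.getElem_cons_succ] at this
    rw [this]; congr 1; omega
  have step : ∀ m, m ≤ u.length → ∃ N, P (k+1+m) = P (k+1) + N ∧ P (k'+1+m) = P (k'+1) + N ∧
      ∀ j ≤ N, x (P (k+1) + j) = x (P (k'+1) + j) := by
    intro m
    induction m with
    | zero => 
      intro _
      refine ⟨0, rfl, rfl, fun j hj => ?_⟩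
      obtain rfl : j = 0 := by omega
      simp [hx0]
    | succ m ih =>
      intro hm
      obtain ⟨N, e1, e2, e3⟩ := ih (by omega)
      have hw : w (k+1+m) = w (k'+1+m) := by rw [← hu m hm, ← hu' m hm]
      have p1 := hP (k+1+m)
      have p2 := hP (k'+1+m)
      rw [← hw] at p2
      refine ⟨N + L (w (k+1+m)), by rw [← add_assoc (k+1), p1]; omega,
        by rw [← add_assoc (k'+1), p2]; omega, fun j hj => ?_⟩
      by_cases hj1 : j ≤ N
      · exact e3 j hj1
      by_cases hj2 : j = N + L (w (k+1+m))
      · have q1 := hx0 (k+1+m+1)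
        have q2 := hx0 (k'+1+m+1)
        rw [p1, e1] at q1
        rw [p2, e2] at q2
        rw [hj2, ← add_assoc, ← add_assoc, q1, q2]
      · obtain ⟨i, rfl⟩ : ∃ i, j = N + i := ⟨j - N, by omega⟩
        have q1 := hF (k+1+m) i (by omega)
        have q2 := hF (k'+1+m) i (by rw [← hw]; omega)
        rw [e1] at q1
        rw [e2] at q2
        rw [← add_assoc, ← add_assoc, q1, q2, hw]
  obtain ⟨N, e1, e2, e3⟩ := step _ le_rfl
  have hpre : ∀ j ≤ N, x j = x (P (k+1) + j) := by
    have := hLSP (List.ofFn (fun i : Fin (N+1) => x (P (k+1) + i))) ⟨a, b, hab, 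
      ⟨P (k+1) - 1, ?_⟩, ⟨P (k'+1) - 1, ?_⟩⟩
    · intro j hj
      have := this j (by simp; omega)
      simpa [-List.ofFn_succ] using this.symm
    · have := hP k
      have := hL k
      rintro (_|i) h
      · simpa [hka] using (hxl k _ (by omega)).symm
      · simp only [List.get_eq_getElem, List.getElem_cons_succ, List.getElem_ofFn]
        congr 1; omega
    · have := hP k'
      have := hL k'
      rintro (_|i) h
      · simpa [hkb] using (hxl k' _ (by omega)).symm
      · simp only [List.get_eq_getElem, List.getElem_cons_succ, List.getElem_ofFn, List.length_cons, List.length_ofFn] at h ⊢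
        rw [e3 _ (by omega)]
        congr 1; omega
  have hmono : StrictMono P := strictMono_nat_of_lt_succ fun n => by
    have := hP n; have := hL n; omega
  have fin : ∀ m, m ≤ u.length → P (k+1+m) = P (k+1) + P m ∧
      ∀ i < m, w i = w (k+1+i) := by
    intro m
    induction m with
    | zero => intro _; simp [h0]
    | succ m ih =>
      intro hm
      obtain ⟨i1, i2⟩ := ih (by omega)
      have p1 := hP (k+1+m)
      have p2 := hP m
      have l1 := hL (k+1+m)
      have l2 := hL m
      have le : P (k+1+m+1) ≤ P (k+1+u.length) := hmono.monotone (by omega)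
      have hlen : L (w m) = L (w (k+1+m)) := by
        rcases lt_trichotomy (L (w m)) (L (w (k+1+m))) with h | h | h
        · exfalso
          have q := hpre (P (m+1)) (by omega)
          rw [hx0, p2, ← add_assoc, ← i1, hF _ _ h] at q
          exact hα' _ _ l2 h q.symm
        · exact h
        · exfalso
          have q := hpre (P m + L (w (k+1+m))) (by omega)
          rw [← add_assoc, ← i1, ← p1, hx0, hF _ _ h] at q
          exact hα' _ _ l1 h q
      have hw : w m = w (k+1+m) := by
        rw [← hxl m (P (m+1) - 1) (by omega), ← hxl (k+1+m) (P (k+1) + (P (m+1) - 1)) (by omega)]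
        exact hpre _ (by omega)
      refine ⟨by rw [← add_assoc (k+1)]; omega, fun i hi => ?_⟩
      rcases Nat.lt_succ_iff_lt_or_eq.mp hi with h | rfl
      · exact i2 i h
      · exact hw
  intro i h
  rw [List.get_eq_getElem, hu i h, (fin _ le_rfl).2 i h]

/-- if the image of an infinite word under an R-bLSP morphism is LSP,
then the word itself is LSP. -/
theorem lsp_of_image_lsp {A : Type*} (D : Set A) (f : A → List A)
    (hf : IsRBLSPOn D f) (w x : ℕ → A) (hw : Set.range w ⊆ D)
    (hx : InfImage f w x) (hLSP : IsLSP x) : IsLSP w := by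
  obtain ⟨hD, g, hg, hfg⟩ := hf
  obtain ⟨α, hα⟩ := blsp_shape g hg
  have hsh : ∀ n, ∃ t : List A, f (w n) = α :: t ∧ α ∉ t ∧ ∃ s, f (w n) = s ++ [w n] := fun n => by
    rw [hfg _ (hw ⟨n, rfl⟩)]; exact hα _
  have hsucc : ∀ n, applyM f (infPrefix w (n+1)) = applyM f (infPrefix w n) ++ f (w n) := fun n => by
    rw [infPrefix, List.ofFn_succ', List.concat_eq_append]
    simp [applyM, infPrefix, -List.ofFn_succ]
  refine lsp_abstract w x α (fun n => (applyM f (infPrefix w n)).length) (fun a => (f a).length)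
    (fun a i => (f a).getD i α) (by simp [applyM, infPrefix]) (fun n => by simp [hsucc])
    ?_ ?_ ?_ ?_ ?_ hLSP
  · intro n
    obtain ⟨t, ht, -⟩ := hsh n
    simp [ht]
  · intro n i hi
    have := hx (n+1) ((applyM f (infPrefix w n)).length + i) (by simp [hsucc]; exact hi)
    simp only [hsucc, List.get_eq_getElem] at this
    rw [List.getElem_append_right (by omega)] at this
    simp only [Nat.add_sub_cancel_left] at this
    rw [← this, List.getD_eq_getElem]
  · intro n
    obtain ⟨t, ht, -⟩ := hsh n
    simp [ht]
  · intro n i h0 hi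
    obtain ⟨t, ht, hn, -⟩ := hsh n
    obtain ⟨i, rfl⟩ : ∃ j, i = j + 1 := ⟨i - 1, by omega⟩
    simp only [ht, List.length_cons, Nat.add_lt_add_iff_right] at hi
    simp only [ht, List.getD_cons_succ]
    rw [List.getD_eq_getElem _ _ hi]
    intro h
    exact hn (h ▸ List.getElem_mem hi)
  · intro n
    obtain ⟨t, -, -, s, hs⟩ := hsh n
    generalize w n = c at hs ⊢
    show (f c).getD ((f c).length - 1) α = c
    rw [hs]
    simp
end

section
/- Every infinite LSP word over a finite alphabet A is S_{R-bLSP}(A)-adic; moreover, every infinite LSP word over A has exactly one fitted directive word over S_{R-bLSP}(A). -/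
theorem pfx_iff {A : Type*} (u : List A) (w : ℕ → A) :
    IsPrefixI u w ↔ ∀ (i : ℕ) (h : i < u.length), u[i] = w i := Iff.rfl

theorem applyM_succ {A : Type*} (f : A → List A) (w : ℕ → A) (n : ℕ) :
    applyM f (infPrefix w (n+1)) = applyM f (infPrefix w n) ++ f (w n) := by
  unfold applyM infPrefix
  rw [List.ofFn_succ_last]
  simp

/-- Decomposition of `w` into blocks. -/
def DecP {A : Type*} (f : A → List A) (v w : ℕ → A) (P : ℕ → ℕ) : Prop :=
  P 0 = 0 ∧ ∀ k, P (k+1) = P k + (f (v k)).length ∧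
    ∀ (i : ℕ) (h : i < (f (v k)).length), (f (v k))[i] = w (P k + i)

theorem infImage_of_dec {A : Type*} {f : A → List A} {v w : ℕ → A} {P : ℕ → ℕ}
    (h : DecP f v w P) : InfImage f v w := by
  have key : ∀ n, (applyM f (infPrefix v n)).length = P n ∧
      IsPrefixI (applyM f (infPrefix v n)) w := by
    intro n
    induction n with
    | zero => refine ⟨by simp [applyM, infPrefix, h.1], ?_⟩
              intro i hi
              simp [applyM, infPrefix] at hi
    | succ n ih =>
      rw [applyM_succ]
      refine ⟨by rw [List.length_append, ih.1, (h.2 n).1], ?_⟩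
      rw [pfx_iff]
      intro i hi
      rw [List.getElem_append]
      split_ifs with h1
      · exact ih.2 i h1
      · rw [(h.2 n).2]
        rw [ih.1] at h1 ⊢
        congr 1
        omega
  exact fun n => (key n).2

theorem dec_of_infImage {A : Type*} {f : A → List A} {v w : ℕ → A}
    (h : InfImage f v w) : DecP f v w (fun n => (applyM f (infPrefix v n)).length) := by
  refine ⟨by simp [applyM, infPrefix], fun k => ⟨by simp [applyM_succ], ?_⟩⟩
  intro i hi
  have := h (k+1)
  rw [pfx_iff, applyM_succ] at this
  have := this ((applyM f (infPrefix v k)).length + i) (by simp [hi])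
  simpa using this

theorem blsp_form {A : Type*} {g : A → List A} {α : A} (h0 : g α = [α])
    (h1 : ∀ β : A, β ≠ α → ∃ γ : A, g β = g γ ++ [β]) :
    ∀ (n : ℕ) (β : A), (g β).length = n → ∃ t, g β = α :: t ∧ α ∉ t ∧ (g β).getLast? = some β := by
  intro n
  induction n using Nat.strong_induction_on with
  | _ n ih =>
    intro β hn
    by_cases hβ : β = α
    · subst hβ
      exact ⟨[], by simp [h0]⟩
    · obtain ⟨γ, hγ⟩ := h1 β hβ
      obtain ⟨t, ht, hat, -⟩ := ih (g γ).length (by rw [← hn, hγ]; simp) γ rfl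
      refine ⟨t ++ [β], by simp [hγ, ht], ?_, by simp [hγ]⟩
      simp [hat, Ne.symm hβ]

theorem fitted_props {A : Type*} {f : A → List A} {v w : ℕ → A} {P : ℕ → ℕ}
    (hf : IsRBLSPOn (Set.range v) f) (h : DecP f v w P) :
    StrictMono P ∧ Set.range P = {n | w n = w 0} ∧ (∀ k, v k = w (P (k+1) - 1)) := by
  obtain ⟨hD, g, ⟨α, h0, h1⟩, hg⟩ := hf
  have form : ∀ k, ∃ t, f (v k) = α :: t ∧ α ∉ t ∧ (f (v k)).getLast? = some (v k) := by
    intro k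
    rw [hg _ ⟨k, rfl⟩]
    exact blsp_form h0 h1 _ _ rfl
  have hlt : ∀ k, P k < P (k+1) := by
    intro k
    obtain ⟨t, ht, -⟩ := form k
    rw [(h.2 k).1, ht]; simp
  have hmono : StrictMono P := strictMono_nat_of_lt_succ hlt
  have hα : ∀ k, w (P k) = α := by
    intro k
    obtain ⟨t, ht, -⟩ := form k
    have := (h.2 k).2 0 (by simp [ht])
    simp [ht] at this
    exact this.symm
  have hw0 : w 0 = α := by simpa [h.1] using hα 0
  refine ⟨hmono, ?_, ?_⟩
  · ext n
    simp only [Set.mem_range, Set.mem_setOf_eq, hw0]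
    constructor
    · rintro ⟨k, rfl⟩; exact hα k
    · intro hn
      have hex : ∃ k, n < P (k+1) := ⟨n, lt_of_lt_of_le (Nat.lt_succ_self n) (hmono.le_apply)⟩
      classical
      let k := Nat.find hex
      have hk : n < P (k+1) := Nat.find_spec hex
      have hk' : P k ≤ n := by
        rcases hkk : k with _ | k'
        · simp [h.1]
        · have := Nat.find_min hex (m := k') (by omega)
          omega
      refine ⟨k, ?_⟩
      by_contra hne
      obtain ⟨t, ht, hat, -⟩ := form k
      have hl := (h.2 k).1
      have h2 := (h.2 k).2 (n - P k) (by omega)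
      rw [show P k + (n - P k) = n by omega, hn] at h2
      obtain ⟨j, hj⟩ : ∃ j, n - P k = j + 1 := ⟨n - P k - 1, by omega⟩
      simp only [ht, hj, List.getElem_cons_succ] at h2
      exact hat (h2 ▸ List.getElem_mem _)
  · intro k
    obtain ⟨t, ht, -, hlast⟩ := form k
    have hpos : 0 < (f (v k)).length := by simp [ht]
    rw [List.getLast?_eq_getElem?, List.getElem?_eq_some_iff] at hlast
    obtain ⟨hl, he⟩ := hlast
    rw [(h.2 k).2] at he
    rw [(h.2 k).1, ← Nat.add_sub_assoc hpos] at *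
    exact he.symm

theorem fitted_unique {A : Type*} {f f' : A → List A} {v v' w : ℕ → A}
    (hf : IsRBLSPOn (Set.range v) f) (h : InfImage f v w)
    (hf' : IsRBLSPOn (Set.range v') f') (h' : InfImage f' v' w) : f = f' ∧ v = v' := by
  obtain ⟨P, d⟩ : ∃ P, DecP f v w P := ⟨_, dec_of_infImage h⟩
  obtain ⟨P', d'⟩ : ∃ P, DecP f' v' w P := ⟨_, dec_of_infImage h'⟩
  obtain ⟨m, r, l⟩ := fitted_props hf d
  obtain ⟨m', r', l'⟩ := fitted_props hf' d'
  have hP := (StrictMono.range_inj m m').1 (r.trans r'.symm)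
  rw [← hP] at d' l'
  have hv : v = v' := by
    funext k; rw [l, l']
  subst hv
  refine ⟨?_, rfl⟩
  funext β
  by_cases hβ : β ∈ Set.range v
  · obtain ⟨k, rfl⟩ := hβ
    have e1 := (d.2 k).1
    have e2 := (d'.2 k).1
    apply List.ext_getElem
    · omega
    · intro i h1 h2
      rw [(d.2 k).2, (d'.2 k).2]
  · have a1 : f β = [] := by
      by_contra hc; exact hβ ((hf.1 β).2 hc)
    have a2 : f' β = [] := by
      by_contra hc; exact hβ ((hf'.1 β).2 hc)
    rw [a1, a2]

open Classical in
/-- path back to the last occurrence of `w 0`. -/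
noncomputable def backP {A : Type*} (w : ℕ → A) : ℕ → List A
  | 0 => [w 0]
  | n+1 => if w (n+1) = w 0 then [w 0] else backP w n ++ [w (n+1)]

theorem factor_mk {A : Type*} (w : ℕ → A) (p n : ℕ) (a : A) (u : List A) (ha : a = w p)
    (hu : u.length = n) (h : ∀ i (hi : i < u.length), u[i] = w (p + 1 + i)) :
    IsFactorI (a :: u) w := by
  refine ⟨p, ?_⟩
  intro i hi
  rcases i with _ | i
  · simpa using ha
  · have := h i (by simpa using hi)
    simp only [List.get_eq_getElem, List.getElem_cons_succ]
    rw [this]; congr 1; omega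

theorem lsp_pointwise {A : Type*} {w : ℕ → A} (hw : IsLSP w) (p q n : ℕ) (hne : w p ≠ w q)
    (h : ∀ i < n, w (p + 1 + i) = w (q + 1 + i)) : ∀ i < n, w (p + 1 + i) = w i := by
  have := hw ((List.range n).map (fun i => w (p + 1 + i)))
    ⟨w p, w q, hne, factor_mk w p n _ _ rfl (by simp) (by simp),
      factor_mk w q n _ _ rfl (by simp) (by simpa using h)⟩
  rw [pfx_iff] at this
  intro i hi
  have h3 := this i (by simpa using hi)
  rw [List.getElem_map, List.getElem_range] at h3
  exact h3

theorem backP_eq {A : Type*} {w : ℕ → A} (hw : IsLSP w) :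
    ∀ m n, w m = w n → backP w m = backP w n := by
  have aux : ∀ n, w n = w 0 → backP w n = [w 0] := by
    intro n hn
    cases n <;> simp [backP, hn]
  intro m
  induction m with
  | zero => intro n hn; rw [aux n hn.symm, aux 0 rfl]
  | succ m ih =>
    intro n hn
    by_cases h : w (m+1) = w 0
    · rw [aux _ h, aux n (hn ▸ h)]
    · rcases n with _ | n
      · exact absurd hn h
      · have h' : w (n+1) ≠ w 0 := hn ▸ h
        have : w m = w n := by
          by_contra hc
          apply h
          have := lsp_pointwise hw m n 1 hc (by intro i hi; interval_cases i; simpa using hn) 0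
            (by omega)
          simpa using this
        simp only [backP, if_neg h, if_neg h', ih n this, hn]

theorem backP_seg {A : Type*} (w : ℕ → A) (i : ℕ) (hi : w i = w 0) :
    ∀ j, (∀ s, i < s → s ≤ i + j → w s ≠ w 0) →
      backP w (i + j) = (List.range (j+1)).map (fun t => w (i + t)) := by
  intro j
  induction j with
  | zero => intro _; cases i <;> simp [backP, hi]
  | succ j ih =>
    intro h
    rw [List.range_succ, List.map_append, ← ih (fun s h1 h2 => h s h1 (by omega))]
    have := h (i + (j+1)) (by omega) (by omega)
    rw [← add_assoc] at this ⊢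
    simp [backP, this, ← add_assoc]

theorem inf_first {A : Type*} [Fintype A] {w : ℕ → A} (hw : IsLSP w) :
    {n | w n = w 0}.Infinite := by
  rw [Set.infinite_iff_exists_gt]
  intro a
  by_contra hc
  push Not at hc
  have grow : ∀ j, j ≤ (backP w (a + j)).length := by
    intro j
    induction j with
    | zero => simp
    | succ j ih =>
      have : w (a + j + 1) ≠ w 0 := fun h => by have := hc _ h; omega
      rw [← add_assoc]
      simp [backP, this, ih]
  have fin : (Set.range (fun n => (backP w n).length)).Finite := by
    let F : A → ℕ := Function.extend w (fun n => (backP w n).length) 0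
    refine (Set.finite_range F).subset ?_
    rintro _ ⟨n, rfl⟩
    refine ⟨w n, ?_⟩
    have : (fun n => (backP w n).length).FactorsThrough w := by
      intro m n h
      simp only [backP_eq hw m n h]
    exact this.extend_apply 0 n
  obtain ⟨N, hN⟩ := fin.bddAbove
  have h1 := hN ⟨a + (N+1), rfl⟩
  have h2 := grow (N+1)
  simp only at h1
  omega

theorem lsp_step {A : Type*} [Fintype A] (w : ℕ → A) (hw : IsLSP w) :
    ∃ (v : ℕ → A) (f : A → List A), IsLSP v ∧ IsRBLSPOn (Set.range v) f ∧ InfImage f v w := by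
  classical
  have hinf := inf_first hw
  let q : ℕ → ℕ := Nat.nth (fun n => w n = w 0)
  have hq : StrictMono q := Nat.nth_strictMono hinf
  have hqa : ∀ k, w (q k) = w 0 := fun k => Nat.nth_mem_of_infinite hinf k
  have hqr : ∀ n, w n = w 0 → ∃ k, q k = n := by
    intro n hn
    have := Nat.range_nth_of_infinite hinf
    have h2 : n ∈ Set.range q := by rw [this]; exact hn
    exact h2
  clear_value q
  have hq0 : q 0 = 0 := by
    obtain ⟨k, hk⟩ := hqr 0 rfl
    have := hq.monotone (Nat.zero_le k)
    omega
  have hlt : ∀ k, q k < q (k+1) := fun k => hq (Nat.lt_succ_self k)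
  have hnot : ∀ k s, q k < s → s < q (k+1) → w s ≠ w 0 := by
    intro k s h1 h2 h3
    obtain ⟨j, rfl⟩ := hqr s h3
    have := hq.lt_iff_lt.1 h1
    have := hq.lt_iff_lt.1 h2
    omega
  have hnext : ∀ k t, q k < t → w t = w 0 → (∀ s, q k < s → s < t → w s ≠ w 0) → q (k+1) = t := by
    intro k t h1 h2 h3
    by_contra hne
    rcases lt_or_gt_of_ne hne with h | h
    · exact h3 _ (hlt k) h (hqa _)
    · exact hnot k t h1 h h2
  let v : ℕ → A := fun k => w (q (k+1) - 1)
  let g : A → List A := fun β => if h : ∃ n, w n = β then backP w h.choose else [w 0, β]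
  have hg : ∀ n, g (w n) = backP w n := by
    intro n
    have h : ∃ m, w m = w n := ⟨n, rfl⟩
    simp only [g, dif_pos h]
    exact backP_eq hw _ _ h.choose_spec
  have hgb : IsBLSP g := by
    refine ⟨w 0, by simp [hg, backP], ?_⟩
    intro β hβ
    by_cases h : ∃ n, w n = β
    · obtain ⟨n, rfl⟩ := h
      rcases n with _ | n
      · exact absurd rfl hβ
      · exact ⟨w n, by simp [hg, backP, hβ]⟩
    · refine ⟨w 0, ?_⟩
      rw [hg]
      simp [g, dif_neg h, backP]
  have hgne : ∀ β, g β ≠ [] := by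
    obtain ⟨α, h0, h1⟩ := hgb
    intro β
    obtain ⟨t, ht, -⟩ := blsp_form h0 h1 _ β rfl
    simp [ht]
  let f : A → List A := fun β => if β ∈ Set.range v then g β else []
  have hfv : ∀ k, f (v k) = (List.range (q (k+1) - q k)).map (fun t => w (q k + t)) := by
    intro k
    have h1 : f (v k) = g (v k) := if_pos ⟨k, rfl⟩
    have h2 := hlt k
    rw [h1]
    simp only [v]
    rw [hg]
    have h3 := backP_seg w (q k) (hqa k) (q (k+1) - 1 - q k)
      (fun s a b => hnot k s a (by omega))
    rw [show q k + (q (k+1) - 1 - q k) = q (k+1) - 1 by omega,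
      show q (k+1) - 1 - q k + 1 = q (k+1) - q k by omega] at h3
    exact h3
  have hdec : DecP f v w q := by
    refine ⟨hq0, fun k => ⟨?_, ?_⟩⟩
    · rw [hfv]; have := hlt k; simp; omega
    · intro i hi
      simp [hfv]
  refine ⟨v, f, ?_, ⟨?_, g, hgb, fun x hx => if_pos hx⟩, infImage_of_dec hdec⟩
  · -- LSP
    have hagree : ∀ m k l, (∀ i < m, v (k+i) = v (l+i)) →
        q (k+m) + q l = q (l+m) + q k ∧ ∀ j, q k + j < q (k+m) → w (q k + j) = w (q l + j) := by
      intro m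
      induction m with
      | zero => intro k l _; exact ⟨by simp [add_comm], fun j hj => by simp at hj⟩
      | succ m ih =>
        intro k l h
        obtain ⟨e, a⟩ := ih k l (fun i hi => h i (by omega))
        have hm := h m (by omega)
        have d1 := hdec.2 (k+m)
        have d2 := hdec.2 (l+m)
        rw [hm] at d1
        have d11 := d1.1
        have d21 := d2.1
        simp only [← add_assoc]
        refine ⟨by omega, ?_⟩
        intro j hj
        have hkm : q k ≤ q (k+m) := hq.monotone (by omega)
        by_cases hj' : q k + j < q (k+m)
        · exact a j hj'
        · have x1 := d1.2 (q k + j - q (k+m)) (by omega)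
          have x2 := d2.2 (q k + j - q (k+m)) (by omega)
          rw [x1] at x2
          rw [show q (k+m) + (q k + j - q (k+m)) = q k + j by omega,
            show q (l+m) + (q k + j - q (k+m)) = q l + j by omega] at x2
          exact x2
    rintro u ⟨a, b, hab, ⟨k, hk⟩, ⟨l, hl⟩⟩
    have hka : a = v k := by simpa using hk 0 (by simp)
    have hlb : b = v l := by simpa using hl 0 (by simp)
    have hku : ∀ i (hi : i < u.length), u[i] = v (k+1+i) := by
      intro i hi
      have := hk (i+1) (by simpa using hi)
      simp only [List.get_eq_getElem, List.getElem_cons_succ] at this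
      rw [this]; congr 1; omega
    have hlu : ∀ i (hi : i < u.length), u[i] = v (l+1+i) := by
      intro i hi
      have := hl (i+1) (by simpa using hi)
      simp only [List.get_eq_getElem, List.getElem_cons_succ] at this
      rw [this]; congr 1; omega
    set m := u.length with hmdef
    obtain ⟨e, ag⟩ := hagree m (k+1) (l+1) (fun i hi => by rw [← hku i hi, ← hlu i hi])
    have pk := hlt k
    have pl := hlt l
    have hK : q (k+1) ≤ q (k+1+m) := hq.monotone (by omega)
    have pref := lsp_pointwise hw (q (k+1) - 1) (q (l+1) - 1) (q (k+1+m) - q (k+1) + 1)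
      (by rw [hka, hlb] at hab; exact hab) (by
        intro i hi
        rw [show q (k+1) - 1 + 1 = q (k+1) by omega, show q (l+1) - 1 + 1 = q (l+1) by omega]
        by_cases hi' : q (k+1) + i < q (k+1+m)
        · exact ag i hi'
        · rw [show q (k+1) + i = q (k+1+m) by omega, show q (l+1) + i = q (l+1+m) by omega,
            hqa, hqa])
    rw [show q (k+1) - 1 + 1 = q (k+1) by omega] at pref
    have hpos : ∀ i ≤ m, q (k+1) + q i = q (k+1+i) := by
      intro i
      induction i with
      | zero => intro _; simp [hq0]
      | succ i ih =>
        intro hi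
        have ihi := ih (by omega)
        have z1 := hlt (k+1+i)
        have z2 : q (k+1+i+1) ≤ q (k+1+m) := hq.monotone (by omega)
        have := hnext i (q (k+1+i+1) - q (k+1)) (by omega) (by
            rw [← pref _ (by omega), show q (k+1) + (q (k+1+i+1) - q (k+1)) = q (k+1+i+1) by omega,
              hqa]) (by
            intro s s1 s2
            rw [← pref _ (by omega)]
            exact hnot (k+1+i) _ (by omega) (by omega))
        rw [← add_assoc]
        omega
    rw [pfx_iff]
    intro i hi
    rw [hku i hi]
    have y1 := hpos (i+1) (by omega)
    have y2 := hlt i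
    have y3 : q (k+1+(i+1)) ≤ q (k+1+m) := hq.monotone (by omega)
    have := pref (q (i+1) - 1) (by omega)
    simp only [v]
    rw [← this]
    congr 1
    rw [← add_assoc] at y1
    omega
  · intro x
    by_cases hx : x ∈ Set.range v
    · have : f x = g x := if_pos hx
      simp [this, hgne, hx]
    · have : f x = [] := if_neg hx
      simp [this, hx]

/-- every infinite LSP word is `S_{R-bLSP}`-adic and has exactly one
fitted directive word over `S_{R-bLSP}`. -/
theorem lsp_is_RbLSP_adic {A : Type*} [Fintype A] (w : ℕ → A) (hw : IsLSP w) :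
    (∃ (fs : ℕ → (A → List A)) (ws : ℕ → (ℕ → A)), ws 0 = w ∧
      ∀ n : ℕ, (∃ D : Set A, IsRBLSPOn D (fs n) ∧ Set.range (ws (n + 1)) ⊆ D) ∧
        InfImage (fs n) (ws (n + 1)) (ws n)) ∧
    (∃! fs : ℕ → (A → List A), ∃ ws : ℕ → (ℕ → A), ws 0 = w ∧
      ∀ n : ℕ, IsRBLSPOn (Set.range (ws (n + 1))) (fs n) ∧
        InfImage (fs n) (ws (n + 1)) (ws n)) := by
  have ex : ∃ fs : ℕ → (A → List A), ∃ ws : ℕ → (ℕ → A), ws 0 = w ∧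
      ∀ n : ℕ, IsRBLSPOn (Set.range (ws (n + 1))) (fs n) ∧
        InfImage (fs n) (ws (n + 1)) (ws n) := by
    choose V F hV hR hI using (lsp_step (A := A))
    let T : {x : ℕ → A // IsLSP x} → {x : ℕ → A // IsLSP x} := fun x => ⟨V x.1 x.2, hV x.1 x.2⟩
    let W : ℕ → {x : ℕ → A // IsLSP x} := fun n => T^[n] ⟨w, hw⟩
    have hW : ∀ n, W (n+1) = T (W n) := fun n => Function.iterate_succ_apply' T n _
    refine ⟨fun n => F (W n).1 (W n).2, fun n => (W n).1, rfl, fun n => ?_⟩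
    simp only [hW]
    exact ⟨hR _ _, hI _ _⟩
  obtain ⟨fs, ws, h0, h⟩ := ex
  refine ⟨⟨fs, ws, h0, fun n => ⟨⟨_, (h n).1, subset_rfl⟩, (h n).2⟩⟩,
    fs, ⟨ws, h0, h⟩, ?_⟩
  rintro fs' ⟨ws', h0', h'⟩
  have hws : ∀ n, ws' n = ws n := by
    intro n
    induction n with
    | zero => rw [h0, h0']
    | succ n ih =>
      have h2 := (h' n).2
      rw [ih] at h2
      exact (fitted_unique (h' n).1 h2 (h n).1 (h n).2).2
  funext n
  have h2 := (h' n).2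
  rw [hws n] at h2
  exact (fitted_unique (h' n).1 h2 (h n).1 (h n).2).1
end
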